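/- arXiv:2403.16456 — 2 statements merged into one kernel-verified Lean document; each statement's English description precedes it below -/
import Mathlib

section
/- Let (Γ_a)_{a=0}^{10} be real 32×32 matrices satisfying the 11d Clifford relations (with 1 = the identity matrix Id) together with the volume normalization Γ₀ Γ₁ ⋯ Γ₁₀ = Id. Then every real 32×32 matrix M admits the Clifford expansion M = (1/32) Σ_{p=0}^{5} ((−1)^{p(p−1)/2} / p!) Σ_{a₁,…,a_p=0}^{10} Tr(M Γ_{a₁⋯a_p}) Γ^{a₁⋯a_p}, where for p = 0 the corresponding term is (1/32) Tr(M) · Id. -/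
open Matrix BigOperators

noncomputable section

/-- The 11×11 Minkowski metric `η = diag(−1,+1,…,+1)`. -/
def eta (a b : Fin 11) : ℝ :=
  if a = b then (if a = 0 then -1 else 1) else 0

/-- The 11d Clifford relations `Γ_a Γ_b + Γ_b Γ_a = 2 η_{ab} · 1`. -/
def CliffordRel {A : Type*} [Ring A] [Algebra ℝ A] (Γ : Fin 11 → A) : Prop :=
  ∀ a b : Fin 11, Γ a * Γ b + Γ b * Γ a = (2 * eta a b) • (1 : A)

/-- The antisymmetrized Clifford element
`Γ_{a₁⋯a_p} = (1/p!) Σ_{σ ∈ S_p} sgn(σ) Γ_{a_{σ(1)}} ⋯ Γ_{a_{σ(p)}}`. -/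
def gammaA {A : Type*} [Ring A] [Algebra ℝ A] (Γ : Fin 11 → A) (p : ℕ)
    (a : Fin p → Fin 11) : A :=
  (p.factorial : ℝ)⁻¹ • ∑ σ : Equiv.Perm (Fin p),
    ((Equiv.Perm.sign σ : ℤ) : ℝ) • (List.ofFn fun i => Γ (a (σ i))).prod

/-- The Levi-Civita symbol (lower indices): the sign of `(a₁,…,a₁₁)` as a permutation
of `(0,…,10)`, and `0` if two indices coincide; in particular `ε_{0 1 ⋯ 10} = +1`. -/
def epsL (a : Fin 11 → Fin 11) : ℝ :=
  ∑ σ : Equiv.Perm (Fin 11),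
    if (∀ i, a i = σ i) then ((Equiv.Perm.sign σ : ℤ) : ℝ) else 0
/-- The index-raised antisymmetrized Clifford element
`Γ^{a₁⋯a_p} = Σ_b η^{a₁b₁} ⋯ η^{a_pb_p} Γ_{b₁⋯b_p}`. -/
def gammaU {A : Type*} [Ring A] [Algebra ℝ A] (Γ : Fin 11 → A) (p : ℕ)
    (a : Fin p → Fin 11) : A :=
  ∑ b : Fin p → Fin 11, (∏ i, eta (a i) (b i)) • gammaA Γ p b

open Equiv Equiv.Perm

/-- The sign with which `Γ_c` and `Γ_d` commute. -/
def commSign (c d : Fin 11) : ℝ := if c = d then 1 else -1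

theorem commSign_mul_self (c d : Fin 11) : commSign c d * commSign c d = 1 := by
  unfold commSign; split_ifs <;> norm_num

theorem prod_commSign_mul_self {p : ℕ} (c : Fin 11) (a : Fin p → Fin 11) :
    (∏ i, commSign c (a i)) * ∏ i, commSign c (a i) = 1 := by
  rw [← Finset.prod_mul_distrib]
  simp [commSign_mul_self]

theorem prod_commSign_of_notMem {p : ℕ} {c : Fin 11} {a : Fin p → Fin 11}
    (h : c ∉ Set.range a) : ∏ i, commSign c (a i) = (-1) ^ p := by
  have h' : ∀ i, commSign c (a i) = -1 := fun i => if_neg fun e => h ⟨i, e.symm⟩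
  simp [h']

theorem prod_commSign_of_mem {p : ℕ} {c : Fin 11} {a : Fin p → Fin 11}
    (ha : Function.Injective a) (h : c ∈ Set.range a) :
    ∏ i, commSign c (a i) = -(-1) ^ p := by
  obtain ⟨j, rfl⟩ := h
  cases p with
  | zero => exact j.elim0
  | succ n =>
    rw [Fin.prod_univ_succAbove _ j]
    have h' : ∀ i, commSign (a j) (a (j.succAbove i)) = -1 := fun i =>
      if_neg fun e => Fin.succAbove_ne j i (ha e).symm
    have hj : commSign (a j) (a j) = 1 := if_pos rfl
    simp [h', hj, pow_succ]

/-- Two index sets of total size at most `10` are separated by their commutation signs. -/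
theorem exists_prod_commSign_mul_eq_neg_one {p q : ℕ} (hpq : p + q ≤ 10) {a : Fin p → Fin 11}
    {b : Fin q → Fin 11} (ha : Function.Injective a) (hb : Function.Injective b)
    (hab : Set.range a ≠ Set.range b) :
    ∃ c, (∏ i, commSign c (a i)) * ∏ i, commSign c (b i) = -1 := by
  rcases Nat.even_or_odd (p + q) with h | h
  · have h1 : (-1 : ℝ) ^ p * (-1) ^ q = 1 := by rw [← pow_add, h.neg_one_pow]
    obtain ⟨c, hc⟩ : ∃ c, ¬(c ∈ Set.range a ↔ c ∈ Set.range b) := by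
      by_contra! h'
      exact hab (Set.ext h')
    refine ⟨c, ?_⟩
    by_cases hca : c ∈ Set.range a
    · have hcb : c ∉ Set.range b := fun h => hc ⟨fun _ => h, fun _ => hca⟩
      rw [prod_commSign_of_mem ha hca, prod_commSign_of_notMem hcb, neg_mul, h1]
    · have hcb : c ∈ Set.range b := by tauto
      rw [prod_commSign_of_notMem hca, prod_commSign_of_mem hb hcb, mul_neg, h1]
  · have h1 : (-1 : ℝ) ^ p * (-1) ^ q = -1 := by rw [← pow_add, h.neg_one_pow]
    obtain ⟨c, hc⟩ : ∃ c, c ∉ Finset.univ.image a ∪ Finset.univ.image b := by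
      by_contra! h'
      have h2 := Finset.card_union_le (Finset.univ.image a) (Finset.univ.image b)
      rw [Finset.eq_univ_of_forall h', Finset.card_image_of_injective _ ha,
        Finset.card_image_of_injective _ hb] at h2
      simp at h2
      omega
    simp only [Finset.mem_union, Finset.mem_image, Finset.mem_univ, true_and, not_or] at hc
    exact ⟨c, by rw [prod_commSign_of_notMem hc.1, prod_commSign_of_notMem hc.2, h1]⟩

theorem prod_ofFn_comp_swap {A : Type*} [Ring A] {n : ℕ} {f : Fin (n + 1) → A}
    (hf : ∀ i j, i ≠ j → f i * f j = -(f j * f i)) (i : Fin n) :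
    (List.ofFn fun k => f (swap i.castSucc i.succ k)).prod = -(List.ofFn f).prod := by
  induction n with
  | zero => exact i.elim0
  | succ n ih =>
    refine Fin.cases ?_ (fun j => ?_) i
    · have h (k : Fin n) : swap (0 : Fin (n + 2)) 1 k.succ.succ = k.succ.succ :=
        swap_apply_of_ne_of_ne (Fin.succ_ne_zero _)
          fun e => Fin.succ_ne_zero k (Fin.succ_injective _ (e.trans Fin.succ_zero_eq_one.symm))
      simp only [List.ofFn_succ, List.prod_cons, Fin.castSucc_zero, Fin.succ_zero_eq_one,
        swap_apply_left, swap_apply_right, h]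
      rw [← mul_assoc, ← mul_assoc, hf 1 0 (by simp), neg_mul]
    · have h0 : swap j.succ.castSucc j.succ.succ (0 : Fin (n + 2)) = 0 :=
        swap_apply_of_ne_of_ne (by simp [Fin.ext_iff]) (Fin.succ_ne_zero _).symm
      have h (k : Fin (n + 1)) : swap j.succ.castSucc j.succ.succ k.succ
          = (swap j.castSucc j.succ k).succ := by
        rw [← Fin.succ_castSucc]
        exact (Fin.succ_injective _).swap_apply _ _ _
      rw [List.ofFn_succ, List.ofFn_succ (f := f), List.prod_cons, List.prod_cons, h0]
      simp only [h]
      rw [ih (f := fun k => f k.succ) (fun i j hij => hf _ _ fun e => hij (Fin.succ_injective _ e)),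
        mul_neg]

section Algebra

variable {A : Type*} [Ring A] [Algebra ℝ A]

/-- A product of pairwise anticommuting factors is antisymmetric under permutations. -/
theorem prod_ofFn_comp_perm {n : ℕ} (σ : Perm (Fin n)) {f : Fin n → A}
    (hf : ∀ i j, i ≠ j → f i * f j = -(f j * f i)) :
    (List.ofFn fun k => f (σ k)).prod = ((sign σ : ℤ) : ℝ) • (List.ofFn f).prod := by
  cases n with
  | zero => simp [Subsingleton.elim σ 1]
  | succ n =>
    have hσ : σ ∈ Submonoid.closure (Set.range fun i : Fin n => swap i.castSucc i.succ) := by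
      rw [mclosure_swap_castSucc_succ]; trivial
    induction hσ using Submonoid.closure_induction generalizing f with
    | mem τ hτ =>
      obtain ⟨i, rfl⟩ := hτ
      rw [prod_ofFn_comp_swap hf, sign_swap (Fin.castSucc_lt_succ).ne]
      simp
    | one => simp
    | mul σ τ _ _ hσ hτ =>
      simp only [Perm.mul_apply]
      rw [hτ (f := fun k => f (σ k)) (fun i j hij => hf _ _ fun e => hij (σ.injective e)),
        hσ hf, smul_smul, Perm.sign_mul]
      push_cast
      rw [mul_comm]

theorem gammaA_comp_perm (Γ : Fin 11 → A) {p : ℕ} (a : Fin p → Fin 11) (τ : Perm (Fin p)) :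
    gammaA Γ p (a ∘ τ) = ((sign τ : ℤ) : ℝ) • gammaA Γ p a := by
  unfold gammaA
  rw [smul_comm]
  congr 1
  rw [Finset.smul_sum]
  refine Fintype.sum_equiv (Equiv.mulLeft τ) _ _ fun σ => ?_
  rw [smul_smul]
  simp only [Equiv.coe_mulLeft, Perm.sign_mul, Units.val_mul, Int.cast_mul, Function.comp_apply,
    Perm.mul_apply]
  rw [← mul_assoc, ← Int.cast_mul, ← Units.val_mul, Int.units_mul_self]
  simp

theorem gammaA_eq_zero_of_not_injective (Γ : Fin 11 → A) {p : ℕ} {a : Fin p → Fin 11}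
    (ha : ¬Function.Injective a) : gammaA Γ p a = 0 := by
  simp only [Function.Injective, not_forall] at ha
  obtain ⟨i, j, hij, hne⟩ := ha
  have h := gammaA_comp_perm Γ a (swap i j)
  rw [comp_swap_eq_update, hij, Function.update_eq_self, ← hij, Function.update_eq_self,
    sign_swap hne] at h
  simp only [Units.val_neg, Units.val_one, Int.cast_neg, Int.cast_one, neg_smul, one_smul] at h
  have h2 : (2 : ℝ) • gammaA Γ p a = 0 := by
    rw [two_smul]; nth_rewrite 1 [h]; exact neg_add_cancel _
  exact (smul_eq_zero_iff_right two_ne_zero).1 h2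

theorem gammaU_eq (Γ : Fin 11 → A) {p : ℕ} (a : Fin p → Fin 11) :
    gammaU Γ p a = (∏ i, eta (a i) (a i)) • gammaA Γ p a := by
  refine Finset.sum_eq_single a (fun b _ hb => ?_) (by simp)
  obtain ⟨i, hi⟩ := Function.ne_iff.1 hb
  rw [Finset.prod_eq_zero (Finset.mem_univ i) (if_neg hi.symm), zero_smul]

variable {Γ : Fin 11 → A}

theorem CliffordRel.mul_self (hC : CliffordRel Γ) (a : Fin 11) :
    Γ a * Γ a = eta a a • (1 : A) := by
  have h := hC a a
  rw [← two_smul ℝ, mul_smul] at h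
  exact smul_right_injective A (two_ne_zero (α := ℝ)) h

theorem CliffordRel.mul_comm_neg (hC : CliffordRel Γ) {a b : Fin 11} (hab : a ≠ b) :
    Γ a * Γ b = -(Γ b * Γ a) := by
  have h := hC a b
  rw [eta, if_neg hab, mul_zero, zero_smul] at h
  exact eq_neg_of_add_eq_zero_left h

theorem CliffordRel.mul_eq_commSign_smul (hC : CliffordRel Γ) (c d : Fin 11) :
    Γ c * Γ d = commSign c d • (Γ d * Γ c) := by
  unfold commSign
  split_ifs with h
  · rw [h, one_smul]
  · rw [hC.mul_comm_neg h, neg_one_smul]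

theorem CliffordRel.mul_prod_ofFn (hC : CliffordRel Γ) (c : Fin 11) {p : ℕ}
    (a : Fin p → Fin 11) :
    Γ c * (List.ofFn fun i => Γ (a i)).prod
      = (∏ i, commSign c (a i)) • ((List.ofFn fun i => Γ (a i)).prod * Γ c) := by
  induction p with
  | zero => simp
  | succ n ih =>
    rw [List.ofFn_succ, List.prod_cons, ← mul_assoc, hC.mul_eq_commSign_smul, smul_mul_assoc,
      mul_assoc, ih fun i => a i.succ, mul_smul_comm, smul_smul, Fin.prod_univ_succ, mul_assoc]

theorem CliffordRel.mul_gammaA (hC : CliffordRel Γ) (c : Fin 11) {p : ℕ} (a : Fin p → Fin 11) :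
    Γ c * gammaA Γ p a = (∏ i, commSign c (a i)) • (gammaA Γ p a * Γ c) := by
  unfold gammaA
  rw [mul_smul_comm, smul_mul_assoc, smul_comm]
  congr 1
  rw [Finset.mul_sum, Finset.sum_mul, Finset.smul_sum]
  refine Finset.sum_congr rfl fun σ _ => ?_
  rw [mul_smul_comm, smul_mul_assoc, smul_comm, hC.mul_prod_ofFn c fun i => a (σ i),
    Equiv.prod_comp σ fun i => commSign c (a i)]

theorem CliffordRel.gammaA_eq_prod (hC : CliffordRel Γ) {p : ℕ} {a : Fin p → Fin 11}
    (ha : Function.Injective a) : gammaA Γ p a = (List.ofFn fun i => Γ (a i)).prod := by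
  have h (σ : Perm (Fin p)) :
      ((sign σ : ℤ) : ℝ) • (List.ofFn fun i => Γ (a (σ i))).prod
        = (List.ofFn fun i => Γ (a i)).prod := by
    rw [prod_ofFn_comp_perm σ (f := fun i => Γ (a i)) fun i j hij =>
      hC.mul_comm_neg (ha.ne hij), smul_smul, ← Int.cast_mul, ← Units.val_mul,
      Int.units_mul_self]
    simp
  unfold gammaA
  simp only [h]
  rw [Finset.sum_const, Finset.card_univ, Fintype.card_perm, Fintype.card_fin,
    ← Nat.cast_smul_eq_nsmul ℝ, smul_smul,
    inv_mul_cancel₀ (Nat.cast_ne_zero.2 (Nat.factorial_ne_zero p)), one_smul]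

theorem CliffordRel.prod_ofFn_mul_self (hC : CliffordRel Γ) {p : ℕ} {a : Fin p → Fin 11}
    (ha : Function.Injective a) :
    (List.ofFn fun i => Γ (a i)).prod * (List.ofFn fun i => Γ (a i)).prod
      = ((-1) ^ p.choose 2 * ∏ i, eta (a i) (a i)) • (1 : A) := by
  induction p with
  | zero => simp
  | succ n ih =>
    have h := hC.mul_prod_ofFn (a 0) fun i => a i.succ
    rw [prod_commSign_of_notMem (by rintro ⟨i, hi⟩; exact Fin.succ_ne_zero i (ha hi))] at h
    rw [List.ofFn_succ, List.prod_cons]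
    nth_rewrite 2 [h]
    rw [mul_smul_comm, mul_assoc, ← mul_assoc _ _ (Γ (a 0)),
      ih (a := fun i => a i.succ) (ha.comp (Fin.succ_injective _)), smul_mul_assoc, one_mul,
      mul_smul_comm, hC.mul_self, smul_smul, smul_smul, Fin.prod_univ_succ,
      Nat.choose_succ_succ' n 1, Nat.choose_one_right, pow_add]
    congr 1
    ring

theorem CliffordRel.gammaA_mul_self (hC : CliffordRel Γ) {p : ℕ} {a : Fin p → Fin 11}
    (ha : Function.Injective a) :
    gammaA Γ p a * gammaA Γ p a = ((-1) ^ p.choose 2 * ∏ i, eta (a i) (a i)) • (1 : A) := by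
  rw [hC.gammaA_eq_prod ha, hC.prod_ofFn_mul_self ha]

end Algebra

theorem eta_self_mul_self (a : Fin 11) : eta a a * eta a a = 1 := by
  unfold eta; split_ifs <;> simp_all

theorem prod_eta_mul_self {p : ℕ} (a : Fin p → Fin 11) :
    (∏ i, eta (a i) (a i)) * ∏ i, eta (a i) (a i) = 1 := by
  rw [← Finset.prod_mul_distrib]
  simp [eta_self_mul_self]

section Trace

variable {Γ : Fin 11 → Matrix (Fin 32) (Fin 32) ℝ}

theorem CliffordRel.trace_gammaA_mul_self (hC : CliffordRel Γ) {p : ℕ} {a : Fin p → Fin 11}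
    (ha : Function.Injective a) :
    (gammaA Γ p a * gammaA Γ p a).trace
      = 32 * ((-1) ^ p.choose 2 * ∏ i, eta (a i) (a i)) := by
  rw [hC.gammaA_mul_self ha, Matrix.trace_smul, Matrix.trace_one, smul_eq_mul, mul_comm]
  simp

theorem CliffordRel.trace_gammaA_mul_eq_zero (hC : CliffordRel Γ) {p q : ℕ} (hpq : p + q ≤ 10)
    {a : Fin p → Fin 11} {b : Fin q → Fin 11} (ha : Function.Injective a)
    (hb : Function.Injective b) (hab : Set.range a ≠ Set.range b) :
    (gammaA Γ p a * gammaA Γ q b).trace = 0 := by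
  obtain ⟨c, hc⟩ := exists_prod_commSign_mul_eq_neg_one hpq ha hb hab
  set X := gammaA Γ p a * gammaA Γ q b with hX
  have hanti : Γ c * X = -(X * Γ c) := by
    rw [hX, ← mul_assoc, hC.mul_gammaA, smul_mul_assoc, mul_assoc, hC.mul_gammaA, mul_smul_comm,
      smul_smul, hc, neg_one_smul, mul_assoc]
  have h1 : (Γ c * X * Γ c).trace = eta c c * X.trace := by
    rw [Matrix.trace_mul_comm, ← mul_assoc, hC.mul_self, smul_mul_assoc, one_mul,
      Matrix.trace_smul, smul_eq_mul]
  have h2 : (Γ c * X * Γ c).trace = -(eta c c * X.trace) := by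
    rw [hanti, neg_mul, mul_assoc, hC.mul_self, mul_smul_comm, mul_one, Matrix.trace_neg,
      Matrix.trace_smul, smul_eq_mul]
  have h3 : eta c c * X.trace = 0 := by linarith
  have h4 : eta c c * (eta c c * X.trace) = X.trace := by
    rw [← mul_assoc, eta_self_mul_self, one_mul]
  rw [← h4, h3, mul_zero]

/-- The strictly increasing enumeration of a subset of at most five indices. -/
def indexTuple (S : Σ p : Fin 6, {s : Finset (Fin 11) // s.card = p}) : Fin S.1 → Fin 11 :=
  S.2.1.orderEmbOfFin S.2.2

theorem indexTuple_injective (S : Σ p : Fin 6, {s : Finset (Fin 11) // s.card = p}) :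
    Function.Injective (indexTuple S) :=
  (S.2.1.orderEmbOfFin S.2.2).injective

theorem range_indexTuple_injective :
    Function.Injective fun S => Set.range (indexTuple S) := by
  rintro ⟨p, s, hs⟩ ⟨q, t, ht⟩ h
  simp only [indexTuple, Finset.range_orderEmbOfFin, Finset.coe_inj] at h
  subst h
  obtain rfl : p = q := Fin.ext (hs.symm.trans ht)
  rfl

theorem CliffordRel.span_gammaA_eq_top (hC : CliffordRel Γ) :
    Submodule.span ℝ (Set.range fun S => gammaA Γ (S.1 : ℕ) (indexTuple S)) = ⊤ := by
  refine LinearIndependent.span_eq_top_of_card_eq_finrank' ?_ ?_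
  · rw [Fintype.linearIndependent_iff]
    intro g hg T
    have h := congrArg (fun X => (X * gammaA Γ (T.1 : ℕ) (indexTuple T)).trace) hg
    simp only [Finset.sum_mul, Matrix.trace_sum, zero_mul, Matrix.trace_zero, smul_mul_assoc,
      Matrix.trace_smul, smul_eq_mul] at h
    rw [Finset.sum_eq_single T (fun S _ hS => ?_) (by simp),
      hC.trace_gammaA_mul_self (indexTuple_injective T)] at h
    · have h0 : ∏ i, eta (indexTuple T i) (indexTuple T i) ≠ 0 :=
        left_ne_zero_of_mul_eq_one (prod_eta_mul_self _)
      simpa [h0] using h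
    · rw [hC.trace_gammaA_mul_eq_zero (by omega) (indexTuple_injective S)
        (indexTuple_injective T) (range_indexTuple_injective.ne hS), mul_zero]
  · simp only [Fintype.card_sigma, Fintype.card_finset_len, Fintype.card_fin,
      Module.finrank_matrix, Module.finrank_self]
    decide

theorem CliffordRel.sum_trace_gammaA_eq (hC : CliffordRel Γ) {q : ℕ} (hq : q ≤ 5)
    {b : Fin q → Fin 11} (hb : Function.Injective b) :
    ∑ a : Fin q → Fin 11, (gammaA Γ q b * gammaA Γ q a).trace • gammaU Γ q a
      = (32 * (-1) ^ q.choose 2 * q.factorial : ℝ) • gammaA Γ q b := by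
  have hinj : Function.Injective fun σ : Perm (Fin q) => b ∘ σ := fun σ τ h =>
    Equiv.ext fun i => hb (congrFun h i)
  have hzero (a : Fin q → Fin 11) (ha : a ∉ Set.range fun σ : Perm (Fin q) => b ∘ σ) :
      (gammaA Γ q b * gammaA Γ q a).trace • gammaU Γ q a = 0 := by
    by_cases hai : Function.Injective a
    · rw [hC.trace_gammaA_mul_eq_zero (by omega) hb hai, zero_smul]
      intro hr
      refine ha ⟨(Equiv.ofInjective a hai).trans
        ((Equiv.setCongr hr.symm).trans (Equiv.ofInjective b hb).symm), ?_⟩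
      funext i
      simp [Equiv.apply_ofInjective_symm]
    · rw [gammaU_eq, gammaA_eq_zero_of_not_injective Γ hai, smul_zero, smul_zero]
  have hterm (σ : Perm (Fin q)) :
      (gammaA Γ q b * gammaA Γ q (b ∘ σ)).trace • gammaU Γ q (b ∘ σ)
        = (32 * (-1) ^ q.choose 2 : ℝ) • gammaA Γ q b := by
    have hs : ((sign σ : ℤ) : ℝ) * ((sign σ : ℤ) : ℝ) = 1 := by
      rw [← Int.cast_mul, ← Units.val_mul, Int.units_mul_self]; simp
    rw [gammaU_eq, gammaA_comp_perm, mul_smul_comm, Matrix.trace_smul,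
      hC.trace_gammaA_mul_self hb, smul_smul, smul_smul]
    congr 1
    simp only [Function.comp_apply, smul_eq_mul]
    rw [Equiv.prod_comp σ fun i => eta (b i) (b i)]
    linear_combination (32 * (-1) ^ q.choose 2 : ℝ) *
      (((∏ i, eta (b i) (b i)) * ∏ i, eta (b i) (b i)) * hs + prod_eta_mul_self b)
  rw [← Fintype.sum_of_injective _ hinj _ _ hzero fun σ => rfl]
  simp only [hterm]
  rw [Finset.sum_const, Finset.card_univ, Fintype.card_perm, Fintype.card_fin,
    ← Nat.cast_smul_eq_nsmul ℝ, smul_smul, mul_comm]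

theorem CliffordRel.sum_trace_gammaA_eq_zero (hC : CliffordRel Γ) {p q : ℕ} (hp : p ≤ 5)
    (hq : q ≤ 5) (hpq : p ≠ q) {b : Fin q → Fin 11} (hb : Function.Injective b) :
    ∑ a : Fin p → Fin 11, (gammaA Γ q b * gammaA Γ p a).trace • gammaU Γ p a = 0 := by
  refine Finset.sum_eq_zero fun a _ => ?_
  by_cases ha : Function.Injective a
  · rw [hC.trace_gammaA_mul_eq_zero (by omega) hb ha, zero_smul]
    intro hr
    have h := congrArg Set.ncard hr
    rw [← Set.image_univ, ← Set.image_univ, Set.ncard_image_of_injective _ hb,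
      Set.ncard_image_of_injective _ ha] at h
    simp only [Set.ncard_univ, Nat.card_fin] at h
    exact hpq h.symm
  · rw [gammaU_eq, gammaA_eq_zero_of_not_injective Γ ha, smul_zero, smul_zero]

end Trace

/-- Clifford expansion of any real 32×32 matrix:
`M = (1/32) Σ_{p=0}^{5} ((−1)^{p(p−1)/2}/p!) Σ_{a₁,…,a_p} Tr(M Γ_{a₁⋯a_p}) Γ^{a₁⋯a_p}`. -/
theorem clifford_expansion_of_matrix
    (Γ : Fin 11 → Matrix (Fin 32) (Fin 32) ℝ) (hC : CliffordRel Γ)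
    (hV : (List.ofFn Γ).prod = 1) (M : Matrix (Fin 32) (Fin 32) ℝ) :
    M = (32 : ℝ)⁻¹ •
      ∑ p : Fin 6, ((-1 : ℝ) ^ ((p : ℕ) * ((p : ℕ) - 1) / 2) / ((p : ℕ).factorial : ℝ)) •
        ∑ a : Fin (p : ℕ) → Fin 11,
          (M * gammaA Γ (p : ℕ) a).trace • gammaU Γ (p : ℕ) a := by
  have hM : M ∈ Submodule.span ℝ (Set.range fun S => gammaA Γ (S.1 : ℕ) (indexTuple S)) := by
    rw [hC.span_gammaA_eq_top]; trivial
  induction hM using Submodule.span_induction with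
  | mem X hX =>
    obtain ⟨S, rfl⟩ := hX
    have hS := indexTuple_injective S
    rw [Finset.sum_eq_single S.1 (fun p _ hp => ?_) (by simp),
      hC.sum_trace_gammaA_eq (by omega) hS, smul_smul, smul_smul, ← Nat.choose_two_right]
    · have hf : ((S.1 : ℕ).factorial : ℝ) ≠ 0 := Nat.cast_ne_zero.2 (Nat.factorial_ne_zero _)
      have h1 : ((-1 : ℝ) ^ (S.1 : ℕ).choose 2) * (-1) ^ (S.1 : ℕ).choose 2 = 1 := by
        rw [← mul_pow]; simp
      have h2 : (32 : ℝ)⁻¹ * ((-1) ^ (S.1 : ℕ).choose 2 / ((S.1 : ℕ).factorial : ℝ)) *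
          (32 * (-1) ^ (S.1 : ℕ).choose 2 * ((S.1 : ℕ).factorial : ℝ)) = 1 := by
        field_simp
        linear_combination h1
      rw [h2, one_smul]
    · rw [hC.sum_trace_gammaA_eq_zero (by omega) (by omega) (fun h => hp (Fin.ext h)) hS,
        smul_zero]
  | zero => simp
  | add X Y _ _ hX hY =>
    nth_rewrite 1 [hX, hY]
    simp only [add_mul, Matrix.trace_add, add_smul, Finset.sum_add_distrib, smul_add]
  | smul r X _ hX =>
    nth_rewrite 1 [hX]
    simp only [smul_mul_assoc, Matrix.trace_smul, smul_assoc, Finset.smul_sum]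
    simp only [smul_comm r]

end
end

section
/- Let (Γ_a)_{a=0}^{10} be a Majorana representation. Then the 11 + 55 + 462 = 528 bilinear forms on ℝ³² given by (ψ, φ) ↦ (ψ̄ Γ_a φ) for 0 ≤ a ≤ 10, (ψ, φ) ↦ (ψ̄ Γ_{a₁a₂} φ) for 0 ≤ a₁ < a₂ ≤ 10, and (ψ, φ) ↦ (ψ̄ Γ_{a₁⋯a₅} φ) for 0 ≤ a₁ < a₂ < ⋯ < a₅ ≤ 10 are all symmetric, and they form a basis of the 528-dimensional real vector space of symmetric bilinear forms on ℝ³²; in particular, every symmetric bilinear form on ℝ³² is a unique linear combination of them. -/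
open Matrix BigOperators

noncomputable section

/-- A Majorana representation: real 32×32 matrices satisfying the 11d Clifford relations
`Γ_a Γ_b + Γ_b Γ_a = 2 η_{ab} · Id`, the volume normalization `Γ₀ Γ₁ ⋯ Γ₁₀ = Id`,
and the symmetry condition `Γ_aᵀ = Γ₀ Γ_a Γ₀`. -/
def Majorana (Γ : Fin 11 → Matrix (Fin 32) (Fin 32) ℝ) : Prop :=
  CliffordRel Γ ∧ (List.ofFn Γ).prod = 1 ∧ ∀ a, (Γ a)ᵀ = Γ 0 * Γ a * Γ 0

/-- The Majorana spinor pairing `(ψ̄ M φ) := ψᵀ Γ₀ M φ`; for `M = 1` this is `(ψ̄ φ)`. -/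
def pair (Γ : Fin 11 → Matrix (Fin 32) (Fin 32) ℝ) (M : Matrix (Fin 32) (Fin 32) ℝ)
    (ψ φ : Fin 32 → ℝ) : ℝ :=
  ψ ⬝ᵥ (Γ 0 * M).mulVec φ

/-- Product of gamma matrices along a list of indices. -/
def gammaProd (Γ : Fin 11 → Matrix (Fin 32) (Fin 32) ℝ) (l : List (Fin 11)) :
    Matrix (Fin 32) (Fin 32) ℝ :=
  (l.map Γ).prod

section Clifford

variable {Γ : Fin 11 → Matrix (Fin 32) (Fin 32) ℝ}

@[simp]
lemma gammaProd_nil : gammaProd Γ [] = 1 := by simp [gammaProd]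

@[simp]
lemma gammaProd_cons (a : Fin 11) (l : List (Fin 11)) :
    gammaProd Γ (a :: l) = Γ a * gammaProd Γ l := by simp [gammaProd]

lemma gammaProd_append (l l' : List (Fin 11)) :
    gammaProd Γ (l ++ l') = gammaProd Γ l * gammaProd Γ l' := by simp [gammaProd]

lemma CliffordRel.anticomm (h : CliffordRel Γ) {a b : Fin 11} (hab : a ≠ b) :
    Γ a * Γ b = -(Γ b * Γ a) := by
  have := h a b
  rw [eta, if_neg hab, mul_zero, zero_smul] at this
  exact eq_neg_of_add_eq_zero_left this

lemma CliffordRel.mul_self_s8 (h : CliffordRel Γ) (a : Fin 11) :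
    Γ a * Γ a = (if a = 0 then -1 else 1 : ℝ) • (1 : Matrix (Fin 32) (Fin 32) ℝ) := by
  have := h a a
  rw [eta, if_pos rfl, ← two_smul ℝ (Γ a * Γ a), mul_smul] at this
  exact smul_right_injective _ (two_ne_zero' ℝ) this

lemma Majorana.zero_mul_zero (hM : Majorana Γ) : Γ 0 * Γ 0 = -1 := by
  simpa using hM.1.mul_self_s8 0

lemma Majorana.transpose_mul_self (hM : Majorana Γ) (a : Fin 11) : (Γ a)ᵀ * Γ a = 1 := by
  rw [hM.2.2 a]
  rcases eq_or_ne a 0 with rfl | ha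
  · rw [hM.zero_mul_zero, mul_assoc, hM.zero_mul_zero]; simp
  · have h1 := hM.1.mul_self_s8 a
    rw [if_neg ha, one_smul] at h1
    rw [mul_assoc (Γ 0), hM.1.anticomm ha, mul_neg, neg_mul, ← mul_assoc, hM.zero_mul_zero,
      mul_assoc, h1]
    simp

lemma Majorana.transpose_gammaProd_mul_self (hM : Majorana Γ) (l : List (Fin 11)) :
    (gammaProd Γ l)ᵀ * gammaProd Γ l = 1 := by
  induction l with
  | nil => simp
  | cons a t ih =>
    rw [gammaProd_cons, transpose_mul, mul_assoc, ← mul_assoc (Γ a)ᵀ, hM.transpose_mul_self,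
      one_mul, ih]

lemma CliffordRel.mul_gammaProd (h : CliffordRel Γ) (c : Fin 11) (l : List (Fin 11)) :
    Γ c * gammaProd Γ l = (-1 : ℝ) ^ (l.length + l.count c) • (gammaProd Γ l * Γ c) := by
  induction l with
  | nil => simp
  | cons a t ih =>
    rw [gammaProd_cons, mul_assoc (Γ a)]
    rcases eq_or_ne a c with rfl | hac
    · rw [ih, mul_smul_comm, List.length_cons, List.count_cons_self, add_add_add_comm]
      simp [pow_add]
    · rw [← mul_assoc, h.anticomm hac.symm, neg_mul, mul_assoc, ih, mul_smul_comm,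
        List.length_cons, List.count_cons_of_ne hac, add_right_comm, pow_succ, mul_neg_one,
        neg_smul]

lemma CliffordRel.gammaProd_reverse (h : CliffordRel Γ) {l : List (Fin 11)} (hl : l.Nodup) :
    gammaProd Γ l.reverse = (-1 : ℝ) ^ l.length.choose 2 • gammaProd Γ l := by
  induction l with
  | nil => simp
  | cons a t ih =>
    rw [List.nodup_cons] at hl
    rw [List.reverse_cons, gammaProd_append, ih hl.2, gammaProd_cons, gammaProd_cons,
      gammaProd_nil, mul_one, h.mul_gammaProd, List.count_eq_zero_of_not_mem hl.1, smul_smul,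
      List.length_cons, Nat.choose_succ_succ', Nat.choose_one_right, add_zero, pow_add,
      mul_right_comm, ← pow_add, ← two_mul, pow_mul]
    simp

lemma Majorana.transpose_gammaProd_mul_zero (hM : Majorana Γ) (l : List (Fin 11)) :
    (gammaProd Γ l)ᵀ * Γ 0 = (-1 : ℝ) ^ l.length • (Γ 0 * gammaProd Γ l.reverse) := by
  induction l with
  | nil => simp
  | cons a t ih =>
    have h1 : (Γ a)ᵀ * Γ 0 = -(Γ 0 * Γ a) := by
      rw [hM.2.2 a, mul_assoc, hM.zero_mul_zero]; simp
    rw [gammaProd_cons, transpose_mul, mul_assoc, h1, mul_neg, ← mul_assoc, ih,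
      List.reverse_cons, gammaProd_append, List.length_cons, pow_succ, mul_neg_one, neg_smul,
      smul_mul_assoc, mul_assoc]
    simp

lemma Majorana.isSymm_zero_mul_gammaProd (hM : Majorana Γ) {l : List (Fin 11)} (hl : l.Nodup)
    (hodd : Odd (l.length + l.length.choose 2)) : (Γ 0 * gammaProd Γ l).IsSymm := by
  have h0 : (Γ 0)ᵀ = -Γ 0 := by
    rw [hM.2.2 0, hM.zero_mul_zero]; simp
  rw [Matrix.IsSymm, transpose_mul, h0, mul_neg, hM.transpose_gammaProd_mul_zero,
    hM.1.gammaProd_reverse hl, mul_smul_comm, smul_smul, ← pow_add, hodd.neg_one_pow]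
  simp

/-- Words on which some `Γ c` has opposite commutation signs are trace-orthogonal. -/
lemma Majorana.trace_transpose_gammaProd_mul_eq_zero (hM : Majorana Γ) {l l' : List (Fin 11)}
    {c : Fin 11} (hc : Odd ((l.length + l.count c) + (l'.length + l'.count c))) :
    ((gammaProd Γ l)ᵀ * gammaProd Γ l').trace = 0 := by
  have h1 : (Γ c * gammaProd Γ l)ᵀ * (Γ c * gammaProd Γ l')
      = (gammaProd Γ l)ᵀ * gammaProd Γ l' := by
    rw [transpose_mul, mul_assoc, ← mul_assoc (Γ c)ᵀ, hM.transpose_mul_self, one_mul]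
  have h2 : Γ c * (Γ c)ᵀ = 1 := mul_eq_one_comm.1 (hM.transpose_mul_self c)
  have h3 := congrArg trace h1
  rw [hM.1.mul_gammaProd, hM.1.mul_gammaProd, transpose_smul, smul_mul_smul_comm, ← pow_add,
    hc.neg_one_pow, trace_smul, transpose_mul, mul_assoc, trace_mul_comm, mul_assoc, mul_assoc,
    h2, mul_one] at h3
  simp only [smul_eq_mul] at h3
  linarith

/-- Distinct index sets of size at most five are separated by commutation signs. -/
lemma exists_odd_length_add_count {l l' : List (Fin 11)} (hl : l.Nodup) (hl' : l'.Nodup)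
    (hlen : l.length ≤ 5) (hlen' : l'.length ≤ 5) (hne : l.toFinset ≠ l'.toFinset) :
    ∃ c, Odd ((l.length + l.count c) + (l'.length + l'.count c)) := by
  by_contra! hcon
  simp only [Nat.not_odd_iff_even] at hcon
  simp only [hl.count, hl'.count] at hcon
  by_cases hpar : Even (l.length + l'.length)
  · refine hne (Finset.ext fun c => ?_)
    have := hcon c
    rw [List.mem_toFinset, List.mem_toFinset]
    grind
  · have hcompl : l'.toFinset = l.toFinsetᶜ := Finset.ext fun c => by
      have := hcon c
      rw [Finset.mem_compl, List.mem_toFinset, List.mem_toFinset]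
      grind
    have hcard := Finset.card_compl l.toFinset
    rw [← hcompl, List.toFinset_card_of_nodup hl, List.toFinset_card_of_nodup hl',
      Fintype.card_fin] at hcard
    omega

lemma CliffordRel.gammaProd_ofFn_swap (h : CliffordRel Γ) {n : ℕ} (i : Fin n)
    {a : Fin (n + 1) → Fin 11} (ha : Function.Injective a) :
    gammaProd Γ (List.ofFn (a ∘ Equiv.swap i.castSucc i.succ)) = -gammaProd Γ (List.ofFn a) := by
  induction n with
  | zero => exact i.elim0
  | succ n ih =>
    induction i using Fin.cases with
    | zero =>
      have hfix : ∀ j : Fin n, Equiv.swap (0 : Fin (n + 2)) 1 j.succ.succ = j.succ.succ :=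
        fun j => Equiv.swap_apply_of_ne_of_ne (Fin.succ_ne_zero _)
          (fun hj => Fin.succ_ne_zero j (Fin.succ_injective _ hj))
      have h01 : a 1 ≠ a 0 := ha.ne (by simp)
      simp only [List.ofFn_succ, gammaProd_cons, Function.comp_apply, Fin.castSucc_zero,
        Fin.succ_zero_eq_one, Equiv.swap_apply_left, Equiv.swap_apply_right, hfix]
      rw [← mul_assoc, h.anticomm h01, neg_mul, mul_assoc]
    | succ i =>
      have hsucc : ∀ j : Fin (n + 1), Equiv.swap i.succ.castSucc i.succ.succ j.succ
          = (Equiv.swap i.castSucc i.succ j).succ := fun j => by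
        rw [← Fin.succ_castSucc]
        exact ((Fin.succ_injective _).swap_apply _ _ _)
      have hzero : Equiv.swap i.succ.castSucc i.succ.succ 0 = 0 :=
        Equiv.swap_apply_of_ne_of_ne (by rw [← Fin.succ_castSucc]; exact (Fin.succ_ne_zero _).symm)
          (Fin.succ_ne_zero _).symm
      have := ih i (a := fun j => a j.succ) (ha.comp (Fin.succ_injective _))
      rw [List.ofFn_succ, List.ofFn_succ (f := a), gammaProd_cons, gammaProd_cons, ← mul_neg,
        ← this]
      simp only [Function.comp_apply, hzero, hsucc, Function.comp_def]

lemma CliffordRel.gammaProd_ofFn_perm (h : CliffordRel Γ) {n : ℕ} (σ : Equiv.Perm (Fin n))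
    {a : Fin n → Fin 11} (ha : Function.Injective a) :
    gammaProd Γ (List.ofFn (a ∘ σ))
      = ((Equiv.Perm.sign σ : ℤ) : ℝ) • gammaProd Γ (List.ofFn a) := by
  cases n with
  | zero => simp [Subsingleton.elim σ 1]
  | succ n =>
    have hσ : σ ∈ Submonoid.closure
        (Set.range fun i : Fin n => Equiv.swap i.castSucc i.succ) := by
      rw [Equiv.Perm.mclosure_swap_castSucc_succ]; trivial
    induction hσ using Submonoid.closure_induction generalizing a with
    | mem τ hτ =>
      obtain ⟨i, rfl⟩ := hτ
      rw [h.gammaProd_ofFn_swap i ha, Equiv.Perm.sign_swap i.castSucc_lt_succ.ne]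
      simp
    | one => simp
    | mul τ ρ _ _ hτ hρ =>
      rw [Equiv.Perm.coe_mul, ← Function.comp_assoc, hρ (ha.comp τ.injective), hτ ha, smul_smul,
        Equiv.Perm.sign_mul]
      push_cast
      rw [mul_comm]

lemma CliffordRel.gammaA_eq_gammaProd (h : CliffordRel Γ) {p : ℕ} {a : Fin p → Fin 11}
    (ha : Function.Injective a) : gammaA Γ p a = gammaProd Γ (List.ofFn a) := by
  have hterm : ∀ σ : Equiv.Perm (Fin p),
      ((Equiv.Perm.sign σ : ℤ) : ℝ) • (List.ofFn fun i => Γ (a (σ i))).prod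
        = gammaProd Γ (List.ofFn a) := fun σ => by
    have h1 : (List.ofFn fun i => Γ (a (σ i))).prod = gammaProd Γ (List.ofFn (a ∘ σ)) := by
      rw [gammaProd, List.map_ofFn]; rfl
    rw [h1, h.gammaProd_ofFn_perm σ ha, smul_smul, ← Int.cast_mul, ← Units.val_mul,
      Int.units_mul_self]
    simp
  rw [gammaA, Finset.sum_congr rfl fun σ _ => hterm σ, Finset.sum_const, Finset.card_univ,
    Fintype.card_perm, Fintype.card_fin, ← Nat.cast_smul_eq_nsmul ℝ, smul_smul,
    inv_mul_cancel₀ (Nat.cast_ne_zero.2 p.factorial_ne_zero), one_smul]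

end Clifford

/-- A linearly independent family of symmetric matrices of maximal cardinality spans all
symmetric matrices. -/
lemma exists_sum_smul_eq_of_isSymm {n ι : Type*} [Fintype n] [DecidableEq n] [Fintype ι]
    {v : ι → Matrix n n ℝ} (hv : LinearIndependent ℝ v) (hsymm : ∀ i, (v i).IsSymm)
    (hcard : Fintype.card ι = Fintype.card (Sym2 n)) {N : Matrix n n ℝ} (hN : N.IsSymm) :
    ∃ c : ι → ℝ, ∑ i, c i • v i = N := by
  let E : Matrix n n ℝ →ₗ[ℝ] (Sym2 n → ℝ) :=
    { toFun := fun A s => A s.out.1 s.out.2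
      map_add' := fun _ _ => rfl
      map_smul' := fun _ _ => rfl }
  have hE : ∀ A : Matrix n n ℝ, A.IsSymm → E A = 0 → A = 0 := fun A hA h0 => by
    ext i j
    have hij : A s(i, j).out.1 s(i, j).out.2 = 0 := congrFun h0 s(i, j)
    have hout : s(s(i, j).out.1, s(i, j).out.2) = s(i, j) := Quot.out_eq s(i, j)
    rcases Sym2.eq_iff.1 hout with ⟨h1, h2⟩ | ⟨h1, h2⟩
    · rwa [h1, h2] at hij
    · rw [h1, h2] at hij
      rwa [← hA.apply i j]
  have hsum : ∀ c : ι → ℝ, (∑ i, c i • v i).IsSymm := fun c => by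
    rw [Matrix.IsSymm, transpose_sum]
    exact Finset.sum_congr rfl fun i _ => by rw [transpose_smul, (hsymm i).eq]
  let L := E ∘ₗ Fintype.linearCombination ℝ v
  have hL : Function.Injective L := by
    rw [← LinearMap.ker_eq_bot, LinearMap.ker_eq_bot']
    intro c hc
    have := hE _ (hsum c) hc
    exact funext fun i => Fintype.linearIndependent_iff.1 hv c this i
  have hL' : Function.Surjective L :=
    (LinearMap.injective_iff_surjective_of_finrank_eq_finrank (by simp [hcard])).1 hL
  obtain ⟨c, hc⟩ := hL' (E N)
  refine ⟨c, sub_eq_zero.1 (hE _ ((hsum c).sub hN) ?_)⟩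
  rw [map_sub, sub_eq_zero]
  exact hc

/-- A bilinear form is a combination of the forms of the matrices `v i` exactly when its matrix
is the same combination of the `v i`. -/
lemma forall_eq_sum_dotProduct_mulVec_iff {n ι : Type*} [Fintype n] [DecidableEq n] [Fintype ι]
    (v : ι → Matrix n n ℝ) (B : (n → ℝ) →ₗ[ℝ] (n → ℝ) →ₗ[ℝ] ℝ) (c : ι → ℝ) :
    (∀ ψ φ, B ψ φ = ∑ i, c i * (ψ ⬝ᵥ v i *ᵥ φ)) ↔
      ∑ i, c i • v i = LinearMap.toMatrix₂' ℝ B := by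
  have key : ∀ ψ φ, Matrix.toLinearMap₂' ℝ (∑ i, c i • v i) ψ φ
      = ∑ i, c i * (ψ ⬝ᵥ v i *ᵥ φ) := fun ψ φ => by
    simp only [map_sum, map_smul, LinearMap.sum_apply, LinearMap.smul_apply,
      Matrix.toLinearMap₂'_apply', smul_eq_mul]
  simp only [← key]
  constructor
  · intro h
    rw [LinearMap.ext₂ h, LinearMap.toMatrix'_toLinearMap₂']
  · intro h ψ φ
    rw [h, Matrix.toLinearMap₂'_toMatrix']

lemma existsUnique_sum_dotProduct_mulVec {n ι : Type*} [Fintype n] [DecidableEq n] [Fintype ι]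
    {v : ι → Matrix n n ℝ} (hv : LinearIndependent ℝ v) (hsymm : ∀ i, (v i).IsSymm)
    (hcard : Fintype.card ι = Fintype.card (Sym2 n))
    {B : (n → ℝ) →ₗ[ℝ] (n → ℝ) →ₗ[ℝ] ℝ} (hB : ∀ ψ φ, B ψ φ = B φ ψ) :
    ∃! c : ι → ℝ, ∀ ψ φ, B ψ φ = ∑ i, c i * (ψ ⬝ᵥ v i *ᵥ φ) := by
  have hN : (LinearMap.toMatrix₂' ℝ B).IsSymm := Matrix.IsSymm.ext fun i j => by
    rw [LinearMap.toMatrix₂'_apply, LinearMap.toMatrix₂'_apply, hB]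
  simp only [forall_eq_sum_dotProduct_mulVec_iff]
  obtain ⟨c, hc⟩ := exists_sum_smul_eq_of_isSymm hv hsymm hcard hN
  exact ⟨c, hc, fun d hd => hv.fintypeLinearCombination_injective (hd.trans hc.symm)⟩

/-- The labels of the 528 forms: one, two or five increasing indices. -/
abbrev FormIndex : Type :=
  Fin 11 ⊕ {x : Fin 11 × Fin 11 // x.1 < x.2} ⊕
    {a : Fin 5 → Fin 11 // ∀ i j : Fin 5, i < j → a i < a j}

/-- The increasing list of spacetime indices of a label. -/
def FormIndex.toList : FormIndex → List (Fin 11)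
  | .inl a => [a]
  | .inr (.inl x) => [x.1.1, x.1.2]
  | .inr (.inr x) => List.ofFn x.1

namespace FormIndex

lemma sortedLT_toList (i : FormIndex) : i.toList.SortedLT := by
  rcases i with a | x | x
  · simp [toList, List.sortedLT_iff_pairwise]
  · simpa [toList, List.sortedLT_iff_pairwise] using x.2
  · exact List.sortedLT_ofFn_iff.2 fun i j => x.2 i j

lemma length_toList_mem (i : FormIndex) :
    i.toList.length = 1 ∨ i.toList.length = 2 ∨ i.toList.length = 5 := by
  rcases i with a | x | x <;> simp [toList]

lemma toList_injective : Function.Injective toList := by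
  rintro (a | ⟨⟨a, b⟩, h⟩ | x) (a' | ⟨⟨a', b'⟩, h'⟩ | x') hxy
  case inr.inr.inr.inr =>
    rw [Subtype.ext (List.ofFn_injective hxy)]
  all_goals simp_all [toList]

lemma card_eq : Fintype.card FormIndex = Fintype.card (Sym2 (Fin 32)) := by
  have h2 : Fintype.card {x : Fin 11 × Fin 11 // x.1 < x.2} = 55 := by decide +kernel
  have h5 : Fintype.card {a : Fin 5 → Fin 11 // ∀ i j : Fin 5, i < j → a i < a j} = 462 := by
    let e : {a : Fin 5 → Fin 11 // ∀ i j : Fin 5, i < j → a i < a j} ≃ (Fin 5 ↪o Fin 11) :=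
      { toFun := fun a => OrderEmbedding.ofStrictMono a.1 fun i j => a.2 i j
        invFun := fun f => ⟨f, fun _ _ hij => f.strictMono hij⟩
        left_inv := fun _ => rfl
        right_inv := fun _ => rfl }
    rw [← Nat.card_eq_fintype_card, Nat.card_congr (e.trans Set.powersetCard.ofFinEmbEquiv),
      Set.powersetCard.card, Nat.card_eq_fintype_card, Fintype.card_fin]
    rfl
  rw [Sym2.card, Fintype.card_sum, Fintype.card_sum, h2, h5, Fintype.card_fin, Fintype.card_fin]
  rfl

end FormIndex

section Basis

variable {Γ : Fin 11 → Matrix (Fin 32) (Fin 32) ℝ}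

lemma Majorana.isSymm_form (hM : Majorana Γ) (i : FormIndex) :
    (Γ 0 * gammaProd Γ i.toList).IsSymm := by
  refine hM.isSymm_zero_mul_gammaProd i.sortedLT_toList.nodup ?_
  rcases i.length_toList_mem with h | h | h <;> rw [h] <;> decide

lemma Majorana.linearIndependent_form (hM : Majorana Γ) :
    LinearIndependent ℝ fun i : FormIndex => Γ 0 * gammaProd Γ i.toList := by
  rw [Fintype.linearIndependent_iff]
  intro c hc j
  have h0 : ∑ i : FormIndex, c i • gammaProd Γ i.toList = 0 := by
    have := congrArg ((Γ 0)ᵀ * ·) hc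
    simpa only [Finset.mul_sum, mul_smul_comm, ← mul_assoc, hM.transpose_mul_self, one_mul,
      mul_zero] using this
  have hlen : ∀ i : FormIndex, i.toList.length ≤ 5 := fun i => by
    rcases i.length_toList_mem with h | h | h <;> omega
  have horth : ∀ i ≠ j, ((gammaProd Γ j.toList)ᵀ * gammaProd Γ i.toList).trace = 0 :=
    fun i hij => by
      have hne : j.toList.toFinset ≠ i.toList.toFinset := fun h =>
        hij (FormIndex.toList_injective ((List.perm_of_nodup_nodup_toFinset_eq
          j.sortedLT_toList.nodup i.sortedLT_toList.nodup h).eq_of_sortedLE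
            j.sortedLT_toList.sortedLE i.sortedLT_toList.sortedLE)).symm
      obtain ⟨k, hk⟩ := exists_odd_length_add_count j.sortedLT_toList.nodup
        i.sortedLT_toList.nodup (hlen j) (hlen i) hne
      exact hM.trace_transpose_gammaProd_mul_eq_zero hk
  have htr := congrArg (fun A => ((gammaProd Γ j.toList)ᵀ * A).trace) h0
  simp only [Finset.mul_sum, mul_smul_comm, trace_sum, trace_smul, mul_zero, trace_zero] at htr
  rw [Finset.sum_eq_single j (fun i _ hij => by rw [horth i hij, smul_zero])
    (fun h => absurd (Finset.mem_univ j) h), hM.transpose_gammaProd_mul_self, trace_one] at htr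
  simpa using htr

lemma pair_comm_of_isSymm {M : Matrix (Fin 32) (Fin 32) ℝ} (h : (Γ 0 * M).IsSymm)
    (ψ φ : Fin 32 → ℝ) : pair Γ M ψ φ = pair Γ M φ ψ := by
  rw [pair, pair, dotProduct_mulVec, ← mulVec_transpose, h.eq, dotProduct_comm]

end Basis

/-- The 11 + 55 + 462 = 528 bilinear forms `(ψ̄ Γ_a φ)`, `(ψ̄ Γ_{a₁a₂} φ)` (a₁ < a₂),
`(ψ̄ Γ_{a₁⋯a₅} φ)` (a₁ < ⋯ < a₅) are symmetric and form a basis of the space of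
symmetric bilinear forms on ℝ³²: every symmetric bilinear form is a unique linear
combination of them. -/
theorem symmetric_bilinear_basis (Γ : Fin 11 → Matrix (Fin 32) (Fin 32) ℝ)
    (hM : Majorana Γ) :
    (∀ a : Fin 11, ∀ ψ φ : Fin 32 → ℝ,
        pair Γ (gammaA Γ 1 ![a]) ψ φ = pair Γ (gammaA Γ 1 ![a]) φ ψ) ∧
    (∀ x : {x : Fin 11 × Fin 11 // x.1 < x.2}, ∀ ψ φ : Fin 32 → ℝ,
        pair Γ (gammaA Γ 2 ![x.1.1, x.1.2]) ψ φ
          = pair Γ (gammaA Γ 2 ![x.1.1, x.1.2]) φ ψ) ∧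
    (∀ x : {a : Fin 5 → Fin 11 // ∀ i j : Fin 5, i < j → a i < a j},
        ∀ ψ φ : Fin 32 → ℝ,
        pair Γ (gammaA Γ 5 x.1) ψ φ = pair Γ (gammaA Γ 5 x.1) φ ψ) ∧
    (∀ B : (Fin 32 → ℝ) →ₗ[ℝ] (Fin 32 → ℝ) →ₗ[ℝ] ℝ,
      (∀ ψ φ : Fin 32 → ℝ, B ψ φ = B φ ψ) →
      ∃! c : (Fin 11 → ℝ) × ({x : Fin 11 × Fin 11 // x.1 < x.2} → ℝ) ×
              ({a : Fin 5 → Fin 11 // ∀ i j : Fin 5, i < j → a i < a j} → ℝ),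
        ∀ ψ φ : Fin 32 → ℝ,
          B ψ φ = (∑ a : Fin 11, c.1 a * pair Γ (gammaA Γ 1 ![a]) ψ φ)
            + (∑ x : {x : Fin 11 × Fin 11 // x.1 < x.2},
                c.2.1 x * pair Γ (gammaA Γ 2 ![x.1.1, x.1.2]) ψ φ)
            + (∑ x : {a : Fin 5 → Fin 11 // ∀ i j : Fin 5, i < j → a i < a j},
                c.2.2 x * pair Γ (gammaA Γ 5 x.1) ψ φ)) := by
  have h1 : ∀ a, gammaA Γ 1 ![a] = gammaProd Γ (FormIndex.toList (.inl a)) := fun a => by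
    rw [hM.1.gammaA_eq_gammaProd (Function.injective_of_subsingleton _)]
    simp [FormIndex.toList]
  have h2 : ∀ x : {x : Fin 11 × Fin 11 // x.1 < x.2}, gammaA Γ 2 ![x.1.1, x.1.2]
      = gammaProd Γ (FormIndex.toList (.inr (.inl x))) := fun x => by
    rw [hM.1.gammaA_eq_gammaProd (by simpa using x.2.ne)]
    simp [FormIndex.toList]
  have h5 : ∀ x : {a : Fin 5 → Fin 11 // ∀ i j : Fin 5, i < j → a i < a j}, gammaA Γ 5 x.1
      = gammaProd Γ (FormIndex.toList (.inr (.inr x))) := fun x => by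
    rw [hM.1.gammaA_eq_gammaProd (StrictMono.injective fun i j => x.2 i j)]
    rfl
  simp only [h1, h2, h5]
  refine ⟨fun a => pair_comm_of_isSymm (hM.isSymm_form _),
    fun x => pair_comm_of_isSymm (hM.isSymm_form _),
    fun x => pair_comm_of_isSymm (hM.isSymm_form _), fun B hB => ?_⟩
  obtain ⟨c, hc, huniq⟩ := existsUnique_sum_dotProduct_mulVec hM.linearIndependent_form
    hM.isSymm_form FormIndex.card_eq hB
  simp only [Fintype.sum_sum_type, ← add_assoc] at hc huniq
  refine ⟨(fun a => c (.inl a), fun x => c (.inr (.inl x)), fun x => c (.inr (.inr x))), hc,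
    fun d hd => ?_⟩
  rw [← huniq (Sum.elim d.1 (Sum.elim d.2.1 d.2.2)) hd]
  rfl

end
end
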